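/- Every x ∈ S̃_{k+1} can be written as x = d_{A_n} d_{A_{n−1}} ⋯ d_{A_1} for some n ≥ 0 and nonempty proper subsets A_1, …, A_n ⊊ I satisfying A_{m+1} ⊆ A_m − 1 for all 1 ≤ m < n and ℓ(x) = ∑_{m=1}^{n} |A_m|; moreover the sequence (A_1, …, A_n) with these properties is unique (this is the canonical maximal decomposition of x into cyclically decreasing elements). -/

import Mathlib

/-- `x : Equiv.Perm ℤ` is an affine permutation in `S̃_{k+1}`: it commutes with
translation by `k+1` and its window sums to `(k+1)(k+2)/2`. -/
def IsAffinePerm (k : ℕ) (x : Equiv.Perm ℤ) : Prop :=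
  (∀ i : ℤ, x (i + (k + 1)) = x i + (k + 1)) ∧
  ∑ i ∈ Finset.Icc (1 : ℤ) (k + 1), x i = (k + 1) * (k + 2) / 2

/-- The underlying function of the simple generator `s_i`. -/
def sAffFun (k : ℕ) (i : ZMod (k + 1)) (j : ℤ) : ℤ :=
  if (j : ZMod (k + 1)) = i then j + 1
  else if (j : ZMod (k + 1)) = i + 1 then j - 1
  else j

theorem sAffFun_invol (k : ℕ) (i : ZMod (k + 1)) (h : ¬ (1 : ZMod (k + 1)) = 0) :
    Function.Involutive (sAffFun k i) := by
  have hne : i + 1 ≠ i := fun hc => h (by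
    have h2 : i + 1 = i + 0 := by simpa using hc
    exact add_left_cancel h2)
  intro j
  by_cases h1 : (j : ZMod (k + 1)) = i
  · have e1 : sAffFun k i j = j + 1 := if_pos h1
    have hj1 : ((j + 1 : ℤ) : ZMod (k + 1)) = i + 1 := by push_cast; rw [h1]
    have e2 : sAffFun k i (j + 1) = j := by
      unfold sAffFun
      rw [if_neg (by rw [hj1]; exact hne), if_pos hj1]
      ring
    rw [e1, e2]
  · by_cases h2 : (j : ZMod (k + 1)) = i + 1
    · have e1 : sAffFun k i j = j - 1 := by unfold sAffFun; rw [if_neg h1, if_pos h2]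
      have hj1 : ((j - 1 : ℤ) : ZMod (k + 1)) = i := by push_cast; rw [h2]; ring
      have e2 : sAffFun k i (j - 1) = j := by
        unfold sAffFun; rw [if_pos hj1]; ring
      rw [e1, e2]
    · have e1 : sAffFun k i j = j := by unfold sAffFun; rw [if_neg h1, if_neg h2]
      rw [e1, e1]

/-- The simple generator `s_i` of the affine symmetric group, as a permutation of `ℤ`:
it interchanges `m(k+1) + ī` and `m(k+1) + ī + 1` for every `m` (when `k ≥ 1`). -/
noncomputable def sAff (k : ℕ) (i : ZMod (k + 1)) : Equiv.Perm ℤ :=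
  if h : (1 : ZMod (k + 1)) = 0 then 1 else Function.Involutive.toPerm _ (sAffFun_invol k i h)

/-- The Coxeter length of `x`: the least number of simple generators whose product is `x`. -/
noncomputable def affLen (k : ℕ) (x : Equiv.Perm ℤ) : ℕ :=
  sInf {n : ℕ | ∃ w : List (ZMod (k + 1)), w.length = n ∧ x = (w.map (sAff k)).prod}

/-- The right descent set `D_R(x) = {i : ℓ(x s_i) < ℓ(x)}`. -/
noncomputable def rightDescents (k : ℕ) (x : Equiv.Perm ℤ) : Set (ZMod (k + 1)) :=
  {i | affLen k (x * sAff k i) < affLen k x}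

/-- The cyclic interval `[i,j] = {i, i+1, …, j}` of residues mod `k+1`. -/
def cycInt (k : ℕ) (i j : ZMod (k + 1)) : Finset (ZMod (k + 1)) :=
  (Finset.range ((j - i).val + 1)).image fun t : ℕ => i + (t : ZMod (k + 1))

/-- A choice of a "gate" residue not belonging to `A` (when `A` is proper). -/
noncomputable def gate (k : ℕ) (A : Finset (ZMod (k + 1))) : ZMod (k + 1) :=
  if h : ∃ g, g ∉ A then h.choose else 0

/-- The cyclically decreasing element `d_A`: the product of the `s_a`, `a ∈ A`, in an
order where `s_{a+1}` occurs to the left of `s_a` whenever `a, a+1 ∈ A`. -/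
noncomputable def dElt (k : ℕ) (A : Finset (ZMod (k + 1))) : Equiv.Perm ℤ :=
  (((((List.range (k + 1)).reverse.map fun t : ℕ => gate k A + (t : ZMod (k + 1))).filter
      fun a => decide (a ∈ A)).map (sAff k)).prod)

/-- The cyclically increasing element `u_A`: the product of the `s_a`, `a ∈ A`, in an
order where `s_{a+1}` occurs to the right of `s_a` whenever `a, a+1 ∈ A`. -/
noncomputable def uElt (k : ℕ) (A : Finset (ZMod (k + 1))) : Equiv.Perm ℤ :=
  ((((List.range (k + 1)).map fun t : ℕ => gate k A + (t : ZMod (k + 1))).filter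
      fun a => decide (a ∈ A)).map (sAff k)).prod

/-- The right decreasing code: `CRD(x)_i = #{j < ī : x(j) > x(ī)}`. -/
noncomputable def CRD (k : ℕ) (x : Equiv.Perm ℤ) (i : ZMod (k + 1)) : ℕ :=
  Set.ncard {j : ℤ | j < (i.val : ℤ) ∧ x (i.val : ℤ) < x j}

/-- The right increasing code: `CRI(x)_i = #{j > ī + 1 : x(j) < x(ī + 1)}`. -/
noncomputable def CRI (k : ℕ) (x : Equiv.Perm ℤ) (i : ZMod (k + 1)) : ℕ :=
  Set.ncard {j : ℤ | (i.val : ℤ) + 1 < j ∧ x j < x ((i.val : ℤ) + 1)}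

/-- The left decreasing code: `CLD(x)_i = #{j < x⁻¹(ī + 1) : x(j) > ī + 1}`. -/
noncomputable def CLD (k : ℕ) (x : Equiv.Perm ℤ) (i : ZMod (k + 1)) : ℕ :=
  Set.ncard {j : ℤ | j < x.symm ((i.val : ℤ) + 1) ∧ (i.val : ℤ) + 1 < x j}

/-- The left increasing code: `CLI(x)_i = #{j > x⁻¹(ī) : x(j) < ī}`. -/
noncomputable def CLI (k : ℕ) (x : Equiv.Perm ℤ) (i : ZMod (k + 1)) : ℕ :=
  Set.ncard {j : ℤ | x.symm ((i.val : ℤ)) < j ∧ x j < (i.val : ℤ)}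

section AffinePermutations

variable {k : ℕ}

/-- `x` commutes with translation by `k + 1`. -/
def TransComm (k : ℕ) (x : Equiv.Perm ℤ) : Prop :=
  ∀ i : ℤ, x (i + (k + 1)) = x i + (k + 1)

theorem zmod_cast_period (k : ℕ) : ((k : ZMod (k + 1)) + 1) = 0 := by
  exact_mod_cast ZMod.natCast_self (k + 1)

theorem perm_apply_inv (x : Equiv.Perm ℤ) (i : ℤ) : x (x⁻¹ i) = i := x.apply_symm_apply i

theorem perm_inv_apply (x : Equiv.Perm ℤ) (i : ℤ) : x⁻¹ (x i) = i := x.symm_apply_apply i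

theorem TransComm.one : TransComm k 1 := fun _ => rfl

theorem TransComm.mul {x y : Equiv.Perm ℤ} (hx : TransComm k x) (hy : TransComm k y) :
    TransComm k (x * y) := fun i => by
  rw [Equiv.Perm.mul_apply, Equiv.Perm.mul_apply, hy, hx]

theorem TransComm.inv {x : Equiv.Perm ℤ} (hx : TransComm k x) : TransComm k x⁻¹ := fun i => by
  rw [Equiv.Perm.inv_eq_iff_eq, hx, perm_apply_inv]

theorem TransComm.listProd {l : List (Equiv.Perm ℤ)} (h : ∀ x ∈ l, TransComm k x) :
    TransComm k l.prod := by
  induction l with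
  | nil => exact TransComm.one
  | cons a l ih =>
    rw [List.prod_cons]
    exact (h a (by simp)).mul (ih fun x hx => h x (by simp [hx]))

theorem TransComm.apply_add_mul {x : Equiv.Perm ℤ} (hx : TransComm k x) (i m : ℤ) :
    x (i + (k + 1) * m) = x i + (k + 1) * m := by
  induction m with
  | zero => simp
  | succ m ih =>
    have := hx (i + (k + 1) * m)
    rw [show i + ((k : ℤ) + 1) * (m + 1) = i + (k + 1) * m + (k + 1) by ring, this, ih]; ring
  | pred m ih =>
    have := hx (i + (k + 1) * (-m - 1))
    rw [show i + ((k : ℤ) + 1) * (-m - 1) + (k + 1) = i + (k + 1) * (-m) by ring, ih] at this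
    linarith

theorem exists_eq_add_mul_of_cast_eq {i j : ℤ} (h : (i : ZMod (k + 1)) = j) :
    ∃ m : ℤ, i = j + (k + 1) * m := by
  obtain ⟨m, hm⟩ := (ZMod.intCast_eq_intCast_iff_dvd_sub j i (k + 1)).1 h.symm
  exact ⟨m, by push_cast at hm; linarith⟩

theorem TransComm.sub_eq_of_cast_eq {x : Equiv.Perm ℤ} (hx : TransComm k x) {i j : ℤ}
    (h : (i : ZMod (k + 1)) = j) : x i - i = x j - j := by
  obtain ⟨m, rfl⟩ := exists_eq_add_mul_of_cast_eq h
  rw [hx.apply_add_mul]; ring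

theorem TransComm.cast_apply {x : Equiv.Perm ℤ} (hx : TransComm k x) {i j : ℤ}
    (h : (i : ZMod (k + 1)) = j) : (x i : ZMod (k + 1)) = x j := by
  have := congrArg (Int.cast : ℤ → ZMod (k + 1)) (hx.sub_eq_of_cast_eq h)
  push_cast at this
  rw [h] at this
  exact sub_left_injective this

theorem cast_val_cast (r : ZMod (k + 1)) : (((r.val : ℕ) : ℤ) : ZMod (k + 1)) = r := by
  simp

/-- A sum over one period is unchanged by an affine reindexing. -/
theorem TransComm.sum_comp {M : Type*} [AddCommMonoid M] {g : Equiv.Perm ℤ}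
    (hg : TransComm k g) {f : ℤ → M}
    (hf : ∀ i j : ℤ, (i : ZMod (k + 1)) = j → f i = f j) :
    ∑ r : ZMod (k + 1), f (g (r.val : ℤ)) = ∑ r : ZMod (k + 1), f (r.val : ℤ) := by
  refine Fintype.sum_bijective (fun r : ZMod (k + 1) => ((g (r.val : ℤ) : ℤ) : ZMod (k + 1)))
    (Finite.surjective_iff_bijective.1 fun s => ?_) _ _ fun r => hf _ _ (by simp)
  refine ⟨((g⁻¹ (s.val : ℤ) : ℤ) : ZMod (k + 1)), ?_⟩
  have := hg.cast_apply (cast_val_cast (k := k) ((g⁻¹ (s.val : ℤ) : ℤ) : ZMod (k + 1)))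
  simp only [this, perm_apply_inv, cast_val_cast]

/-- The total displacement of `x` over one period. -/
def displacement (k : ℕ) (x : Equiv.Perm ℤ) : ℤ :=
  ∑ r : ZMod (k + 1), (x (r.val : ℤ) - (r.val : ℤ))

theorem displacement_mul {x y : Equiv.Perm ℤ} (hx : TransComm k x) (hy : TransComm k y) :
    displacement k (x * y) = displacement k x + displacement k y := by
  have h := hy.sum_comp (f := fun i => x i - i) fun i j => hx.sub_eq_of_cast_eq
  rw [displacement, displacement, displacement, ← h, ← Finset.sum_add_distrib]
  exact Finset.sum_congr rfl fun r _ => by simp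

theorem displacement_one : displacement k 1 = 0 := by simp [displacement]

theorem displacement_inv {x : Equiv.Perm ℤ} (hx : TransComm k x) :
    displacement k x⁻¹ = - displacement k x := by
  have := displacement_mul hx hx.inv
  rw [mul_inv_cancel, displacement_one] at this
  linarith

theorem displacement_listProd {l : List (Equiv.Perm ℤ)}
    (h : ∀ x ∈ l, TransComm k x ∧ displacement k x = 0) : displacement k l.prod = 0 := by
  induction l with
  | nil => exact displacement_one
  | cons a l ih =>
    have hl : ∀ x ∈ l, TransComm k x ∧ displacement k x = 0 := fun x hx => h x (by simp [hx])
    rw [List.prod_cons, displacement_mul (h a (by simp)).1 (TransComm.listProd fun x hx =>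
      (hl x hx).1), ih hl, (h a (by simp)).2, add_zero]

theorem sum_Icc_eq_sum_zmod {M : Type*} [AddCommMonoid M] {f : ℤ → M}
    (hf : ∀ i j : ℤ, (i : ZMod (k + 1)) = j → f i = f j) :
    ∑ i ∈ Finset.Icc (1 : ℤ) (k + 1), f i = ∑ r : ZMod (k + 1), f (r.val : ℤ) := by
  refine Finset.sum_bij (fun i _ => (i : ZMod (k + 1))) (fun _ _ => Finset.mem_univ _)
    (fun i hi j hj hij => ?_) (fun r _ => ?_) (fun i _ => hf _ _ (by simp))
  · obtain ⟨m, hm⟩ := exists_eq_add_mul_of_cast_eq hij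
    rw [Finset.mem_Icc] at hi hj
    have h1 : m < 1 := by
      by_contra h
      nlinarith
    have h2 : -1 < m := by
      by_contra h
      nlinarith
    have : m = 0 := by omega
    simp [hm, this]
  · have hlt := ZMod.val_lt (r - 1)
    refine ⟨((r - 1).val : ℤ) + 1, ?_, by simp⟩
    rw [Finset.mem_Icc]
    omega

theorem two_mul_sum_Icc (k : ℕ) :
    2 * ∑ i ∈ Finset.Icc (1 : ℤ) (k + 1), i = ((k : ℤ) + 1) * (k + 2) := by
  induction k with
  | zero => simp
  | succ k ih =>
    have : Finset.Icc (1 : ℤ) (((k + 1 : ℕ) : ℤ) + 1) =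
        insert ((k : ℤ) + 2) (Finset.Icc (1 : ℤ) (k + 1)) := by
      ext a
      simp only [Finset.mem_Icc, Finset.mem_insert]
      push_cast
      omega
    rw [this, Finset.sum_insert (by simp), mul_add, ih]
    push_cast
    ring

theorem IsAffinePerm.displacement_eq_zero {x : Equiv.Perm ℤ} (hx : IsAffinePerm k x) :
    displacement k x = 0 := by
  have hc : TransComm k x := hx.1
  rw [displacement, ← sum_Icc_eq_sum_zmod (f := fun i => x i - i) fun i j => hc.sub_eq_of_cast_eq,
    Finset.sum_sub_distrib, hx.2, ← two_mul_sum_Icc]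
  simp

/-! ### Simple generators -/

theorem sAff_apply (hk : 1 ≤ k) (i : ZMod (k + 1)) (j : ℤ) :
    sAff k i j = if (j : ZMod (k + 1)) = i then j + 1
      else if (j : ZMod (k + 1)) = i + 1 then j - 1 else j := by
  have : Fact (1 < k + 1) := ⟨by omega⟩
  rw [sAff, dif_neg one_ne_zero]
  rfl

theorem sAff_transComm (hk : 1 ≤ k) (i : ZMod (k + 1)) : TransComm k (sAff k i) := fun j => by
  simp only [sAff_apply hk]
  push_cast
  rw [zmod_cast_period, add_zero]
  split_ifs <;> ring

theorem sAff_mul_self (k : ℕ) (i : ZMod (k + 1)) : sAff k i * sAff k i = 1 := by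
  rw [sAff]
  split_ifs with h
  · simp
  · ext j
    exact sAffFun_invol k i h j

theorem displacement_sAff (hk : 1 ≤ k) (i : ZMod (k + 1)) : displacement k (sAff k i) = 0 := by
  have := displacement_mul (sAff_transComm hk i) (sAff_transComm hk i)
  rw [sAff_mul_self, displacement_one] at this
  omega

/-! ### Inversion counts -/

/-- The number of positions left of `i` carrying a value larger than `x i`. -/
noncomputable def leftInv (x : Equiv.Perm ℤ) (i : ℤ) : ℕ :=
  Set.ncard {j : ℤ | j < i ∧ x i < x j}

/-- The number of inversions of `x` up to translation. -/
noncomputable def invSum (k : ℕ) (x : Equiv.Perm ℤ) : ℕ :=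
  ∑ r : ZMod (k + 1), leftInv x (r.val : ℤ)

theorem TransComm.exists_bound {x : Equiv.Perm ℤ} (hx : TransComm k x) :
    ∃ B : ℤ, ∀ j, x j ≤ j + B := by
  obtain ⟨B, hB⟩ := (Set.finite_range fun r : ZMod (k + 1) =>
    x (r.val : ℤ) - (r.val : ℤ)).bddAbove
  refine ⟨B, fun j => ?_⟩
  have h1 := hB ⟨(j : ZMod (k + 1)), rfl⟩
  have h2 := hx.sub_eq_of_cast_eq (cast_val_cast (k := k) (j : ZMod (k + 1)))
  simp only at h1
  omega

theorem TransComm.finite_leftInv {x : Equiv.Perm ℤ} (hx : TransComm k x) (i : ℤ) :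
    {j : ℤ | j < i ∧ x i < x j}.Finite := by
  obtain ⟨B, hB⟩ := hx.exists_bound
  refine (Set.finite_Ioo (x i - B) i).subset fun j hj => ?_
  have := hB j
  have := hj.1
  have := hj.2
  constructor <;> omega

theorem TransComm.exists_leftMax {x : Equiv.Perm ℤ} (hx : TransComm k x) :
    ∃ i : ℤ, ∀ j < i, x j < x i := by
  obtain ⟨B, hB⟩ := hx.exists_bound
  obtain ⟨v, ⟨i, hi, rfl⟩, hmax⟩ := Int.exists_greatest_of_bdd (P := fun v => ∃ i ≤ 0, x i = v)
    ⟨B, by rintro _ ⟨i, hi, rfl⟩; have := hB i; omega⟩ ⟨x 0, 0, le_rfl, rfl⟩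
  refine ⟨i, fun j hj => lt_of_le_of_ne (hmax _ ⟨j, by omega, rfl⟩) fun h => ?_⟩
  exact hj.ne (x.injective h)

theorem TransComm.leftInv_eq {x : Equiv.Perm ℤ} (hx : TransComm k x) (i j : ℤ)
    (h : (i : ZMod (k + 1)) = j) : leftInv x i = leftInv x j := by
  obtain ⟨m, rfl⟩ := exists_eq_add_mul_of_cast_eq h
  refine (Set.ncard_congr (fun a _ => a + (k + 1) * m) ?_ ?_ ?_).symm
  · rintro a ⟨h1, h2⟩
    simp only [Set.mem_ofPred_eq, hx.apply_add_mul]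
    constructor <;> linarith
  · intro a b _ _ hab
    linarith
  · rintro b ⟨h1, h2⟩
    refine ⟨b + (k + 1) * (-m), ?_, by ring⟩
    simp only [Set.mem_ofPred_eq, hx.apply_add_mul] at h2 ⊢
    constructor <;> linarith

theorem invSum_one : invSum k 1 = 0 := by
  refine Finset.sum_eq_zero fun r _ => ?_
  rw [leftInv, Set.ncard_eq_zero (TransComm.finite_leftInv (k := k) TransComm.one _)]
  ext j
  simp only [Equiv.Perm.coe_one, id_eq, Set.mem_ofPred_eq, Set.mem_empty_iff_false, iff_false]
  omega

theorem leftInv_mul_sAff_le (hk : 1 ≤ k) {x : Equiv.Perm ℤ} (hx : TransComm k x)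
    (a : ZMod (k + 1)) (i : ℤ) :
    leftInv (x * sAff k a) (sAff k a i) ≤
      leftInv x i + if (i : ZMod (k + 1)) = a then 1 else 0 := by
  have hs : ∀ j, sAff k a (sAff k a j) = j := fun j => by
    rw [← Equiv.Perm.mul_apply, sAff_mul_self]; rfl
  have hfin := hx.finite_leftInv i
  have key : ∀ j, j < sAff k a i → sAff k a j < i ∨
      ((i : ZMod (k + 1)) = a ∧ sAff k a j = i + 1) := by
    intro j hj
    by_contra hcon
    push Not at hcon
    obtain ⟨h1, h2⟩ := hcon
    have hne : sAff k a j ≠ i := fun h => by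
      rw [← h, hs] at hj
      exact lt_irrefl _ hj
    have e := hs j
    have b1 : sAff k a j - 1 ≤ j := by
      rw [sAff_apply hk a (sAff k a j)] at e
      split_ifs at e <;> omega
    rw [sAff_apply hk a i] at hj
    split_ifs at hj with c
    · exact h2 c (by omega)
    · omega
    · omega
  have main : sAff k a '' {j | j < sAff k a i ∧ (x * sAff k a) (sAff k a i) < (x * sAff k a) j} ⊆
      {j | j < i ∧ x i < x j} ∪ (if (i : ZMod (k + 1)) = a then {i + 1} else ∅) := by
    rintro _ ⟨j, ⟨h1, h2⟩, rfl⟩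
    simp only [Equiv.Perm.mul_apply, hs] at h2
    rcases key j h1 with h | ⟨h, h'⟩
    · exact Or.inl ⟨h, h2⟩
    · right; simp [h, h']
  rw [leftInv, ← Set.ncard_image_of_injective _ (sAff k a).injective]
  refine (Set.ncard_le_ncard main (hfin.union (by split_ifs <;> simp))).trans
    ((Set.ncard_union_le _ _).trans ?_)
  rw [leftInv]
  split_ifs <;> simp

theorem invSum_mul_sAff_le (hk : 1 ≤ k) {x : Equiv.Perm ℤ} (hx : TransComm k x)
    (a : ZMod (k + 1)) : invSum k (x * sAff k a) ≤ invSum k x + 1 := by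
  have hs := sAff_transComm hk a
  rw [invSum, ← hs.sum_comp (hx.mul hs).leftInv_eq, invSum]
  refine (Finset.sum_le_sum fun r _ => leftInv_mul_sAff_le hk hx a _).trans ?_
  rw [Finset.sum_add_distrib]
  simp

theorem invSum_word_le (hk : 1 ≤ k) (w : List (ZMod (k + 1))) :
    invSum k (w.map (sAff k)).prod ≤ w.length := by
  induction w using List.reverseRecOn with
  | nil => simp [invSum_one]
  | append_singleton w a ih =>
    rw [List.map_append, List.prod_append, List.length_append]
    simp only [List.map_cons, List.map_nil, List.prod_singleton, List.length_singleton]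
    refine (invSum_mul_sAff_le hk (TransComm.listProd fun y hy => ?_) a).trans (by omega)
    obtain ⟨b, _, rfl⟩ := List.mem_map.1 hy
    exact sAff_transComm hk b

/-! ### Cyclically decreasing elements -/

theorem gate_notMem {A : Finset (ZMod (k + 1))} (hA : A ≠ Finset.univ) : gate k A ∉ A := by
  have h : ∃ g, g ∉ A := by
    by_contra! h
    exact hA (Finset.eq_univ_of_forall h)
  rw [gate, dif_pos h]
  exact h.choose_spec

/-- The word whose product is `dElt k A`. -/
noncomputable def dWord (k : ℕ) (A : Finset (ZMod (k + 1))) : List (ZMod (k + 1)) :=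
  ((List.range (k + 1)).reverse.map fun t : ℕ => gate k A + (t : ZMod (k + 1))).filter
    fun a => decide (a ∈ A)

theorem dElt_eq_dWord (A : Finset (ZMod (k + 1))) : dElt k A = ((dWord k A).map (sAff k)).prod :=
  rfl

theorem length_dWord_le (A : Finset (ZMod (k + 1))) : (dWord k A).length ≤ A.card := by
  have hn : (dWord k A).Nodup := by
    refine List.Nodup.filter _ (List.Nodup.map_on ?_ (List.nodup_reverse.2 List.nodup_range))
    intro a ha b hb hab
    rw [List.mem_reverse, List.mem_range] at ha hb
    have := (ZMod.natCast_eq_natCast_iff' a b (k + 1)).1 (add_left_cancel hab)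
    rwa [Nat.mod_eq_of_lt ha, Nat.mod_eq_of_lt hb] at this
  rw [← List.toFinset_card_of_nodup hn]
  refine Finset.card_le_card fun a ha => ?_
  simpa using (List.mem_filter.1 (List.mem_toFinset.1 ha)).2

theorem dElt_transComm (hk : 1 ≤ k) (A : Finset (ZMod (k + 1))) : TransComm k (dElt k A) :=
  TransComm.listProd fun y hy => by
    obtain ⟨b, _, rfl⟩ := List.mem_map.1 hy
    exact sAff_transComm hk b

theorem displacement_dElt (hk : 1 ≤ k) (A : Finset (ZMod (k + 1))) :
    displacement k (dElt k A) = 0 :=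
  displacement_listProd fun y hy => by
    obtain ⟨b, _, rfl⟩ := List.mem_map.1 hy
    exact ⟨sAff_transComm hk b, displacement_sAff hk b⟩

/-- The product of those letters of `dWord k A` within distance `m` of the gate. -/
noncomputable def dPartial (k : ℕ) (A : Finset (ZMod (k + 1))) (m : ℕ) : Equiv.Perm ℤ :=
  (((((List.range m).reverse.map fun t : ℕ => gate k A + (t : ZMod (k + 1))).filter
      fun a => decide (a ∈ A)).map (sAff k)).prod)

theorem dPartial_succ (A : Finset (ZMod (k + 1))) (m : ℕ) (j : ℤ) :
    dPartial k A (m + 1) j =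
      if gate k A + m ∈ A then sAff k (gate k A + m) (dPartial k A m j) else dPartial k A m j := by
  unfold dPartial
  rw [List.range_succ, List.reverse_append]
  by_cases h : gate k A + (m : ZMod (k + 1)) ∈ A <;> simp [h]

theorem natCast_inj_of_pos_of_le {a b : ℕ} (ha : 1 ≤ a) (ha' : a ≤ k + 1) (hb : 1 ≤ b)
    (hb' : b ≤ k + 1) (h : (a : ZMod (k + 1)) = b) : a = b := by
  have h1 : ((a - 1 : ℕ) : ZMod (k + 1)) = ((b - 1 : ℕ) : ZMod (k + 1)) := by
    rw [Nat.cast_sub ha, Nat.cast_sub hb, h]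
  have := (ZMod.natCast_eq_natCast_iff' _ _ (k + 1)).1 h1
  rw [Nat.mod_eq_of_lt (by omega), Nat.mod_eq_of_lt (by omega)] at this
  omega

theorem sAff_gate_add (hk : 1 ≤ k) {g : ZMod (k + 1)} {G : ℤ} (hG : (G : ZMod (k + 1)) = g)
    {m u : ℕ} (hm : 1 ≤ m) (hm' : m ≤ k) (hu : 1 ≤ u) (hu' : u ≤ k + 1) :
    sAff k (g + m) (G + u) = if u = m then G + u + 1 else if u = m + 1 then G + u - 1
      else G + u := by
  have e1 : (((G + u : ℤ)) : ZMod (k + 1)) = g + m ↔ u = m := by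
    push_cast
    rw [hG, add_right_inj]
    exact ⟨natCast_inj_of_pos_of_le hu hu' hm (by omega), fun h => by rw [h]⟩
  have e2 : (((G + u : ℤ)) : ZMod (k + 1)) = g + m + 1 ↔ u = m + 1 := by
    push_cast
    rw [hG, add_assoc, add_right_inj]
    exact ⟨fun h => natCast_inj_of_pos_of_le hu hu' (by omega) (by omega) (by push_cast; exact h),
      fun h => by rw [h]; push_cast; rfl⟩
  rw [sAff_apply hk]
  simp only [e1, e2]

section

variable {A : Finset (ZMod (k + 1))} {G : ℤ}

theorem pos_of_gate_add_mem (hA : A ≠ Finset.univ) {m : ℕ} (h : gate k A + m ∈ A) : 1 ≤ m := by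
  rcases Nat.eq_zero_or_pos m with rfl | h0
  · exact absurd (by simpa using h) (gate_notMem hA)
  · exact h0

theorem dPartial_of_le (hk : 1 ≤ k) (hA : A ≠ Finset.univ) (hG : (G : ZMod (k + 1)) = gate k A)
    {t : ℕ} (ht : t ≤ k) {m : ℕ} (hm : m ≤ t) :
    dPartial k A m (G + (t + 1 : ℕ)) = G + (t + 1 : ℕ) := by
  induction m with
  | zero => simp [dPartial]
  | succ m ih =>
    rw [dPartial_succ, ih (by omega)]
    split_ifs with h
    · rw [sAff_gate_add hk hG (pos_of_gate_add_mem hA h) (by omega) (by omega) (by omega),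
        if_neg (by omega), if_neg (by omega)]
    · rfl

theorem dPartial_of_mem (hk : 1 ≤ k) (hA : A ≠ Finset.univ) (hG : (G : ZMod (k + 1)) = gate k A)
    {t : ℕ} (hmem : gate k A + t ∈ A) {m : ℕ} (hm : t + 1 ≤ m) (hmk : m ≤ k + 1) :
    dPartial k A m (G + (t + 1 : ℕ)) = G + t := by
  have ht := pos_of_gate_add_mem hA hmem
  induction m, hm using Nat.le_induction with
  | base =>
    rw [dPartial_succ, if_pos hmem, dPartial_of_le hk hA hG (by omega) le_rfl,
      sAff_gate_add hk hG ht (by omega) (by omega) (by omega), if_neg (by omega), if_pos rfl]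
    push_cast
    ring
  | succ m hm ih =>
    rw [dPartial_succ, ih (by omega)]
    split_ifs with h
    · rw [sAff_gate_add hk hG (by omega) (by omega) ht (by omega),
        if_neg (by omega), if_neg (by omega)]
    · rfl

theorem dPartial_of_notMem (hk : 1 ≤ k) (hA : A ≠ Finset.univ)
    (hG : (G : ZMod (k + 1)) = gate k A) {t : ℕ} (hmem : gate k A + t ∉ A) {m : ℕ}
    (hm : t + 1 ≤ m) (hmk : m ≤ k + 1) :
    ∃ u : ℕ, t + 1 ≤ u ∧ u ≤ m ∧ dPartial k A m (G + (t + 1 : ℕ)) = G + u ∧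
      (∀ v, t + 1 ≤ v → v < u → gate k A + v ∈ A) ∧ (u = m ∨ gate k A + u ∉ A) := by
  induction m, hm using Nat.le_induction with
  | base =>
    refine ⟨t + 1, le_rfl, le_rfl, ?_, fun v _ _ => by omega, Or.inl rfl⟩
    rw [dPartial_succ, if_neg hmem, dPartial_of_le hk hA hG (by omega) le_rfl]
  | succ m hm ih =>
    obtain ⟨u, h1, h2, h3, h4, h5⟩ := ih (by omega)
    rw [dPartial_succ, h3]
    by_cases h : gate k A + m ∈ A
    · rw [if_pos h, sAff_gate_add hk hG (by omega) (by omega) (by omega) (by omega)]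
      by_cases hum : u = m
      · refine ⟨m + 1, by omega, le_rfl, ?_, fun v hv hv' => ?_, Or.inl rfl⟩
        · rw [if_pos hum, hum]; push_cast; ring
        · rcases Nat.lt_succ_iff_lt_or_eq.1 hv' with h' | rfl
          · exact h4 v hv (by omega)
          · exact h
      · refine ⟨u, h1, by omega, by rw [if_neg hum, if_neg (by omega)], h4,
          Or.inr (h5.resolve_left hum)⟩
    · refine ⟨u, h1, by omega, by rw [if_neg h], h4, Or.inr ?_⟩
      rcases h5 with rfl | h5
      · exact h
      · exact h5

theorem exists_gate_add (A : Finset (ZMod (k + 1))) (i : ℤ) :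
    ∃ (G : ℤ) (t : ℕ), (G : ZMod (k + 1)) = gate k A ∧ t ≤ k ∧ i = G + t := by
  refine ⟨i - (((i : ZMod (k + 1)) - gate k A).val : ℤ), ((i : ZMod (k + 1)) - gate k A).val,
    by simp, ?_, by ring⟩
  have := ZMod.val_lt ((i : ZMod (k + 1)) - gate k A)
  omega

theorem dElt_of_mem (hk : 1 ≤ k) (hA : A ≠ Finset.univ) {i : ℤ} (hi : (i : ZMod (k + 1)) ∈ A) :
    dElt k A (i + 1) = i := by
  obtain ⟨G, t, hG, ht, rfl⟩ := exists_gate_add A i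
  have := dPartial_of_mem hk hA hG (t := t) (by push_cast at hi; rwa [hG] at hi)
    (m := k + 1) (by omega) le_rfl
  push_cast at this
  rw [add_assoc]
  exact this

theorem dElt_of_notMem (hk : 1 ≤ k) (hA : A ≠ Finset.univ) {i : ℤ}
    (hi : (i : ZMod (k + 1)) ∉ A) :
    i + 1 ≤ dElt k A (i + 1) ∧ ((dElt k A (i + 1) : ℤ) : ZMod (k + 1)) ∉ A ∧
      ∀ j, i + 1 ≤ j → j < dElt k A (i + 1) → (j : ZMod (k + 1)) ∈ A := by
  obtain ⟨G, t, hG, ht, rfl⟩ := exists_gate_add A i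
  obtain ⟨u, h1, h2, h3, h4, h5⟩ := dPartial_of_notMem hk hA hG (t := t)
    (by push_cast at hi; rwa [hG] at hi) (m := k + 1) (by omega) le_rfl
  have h3' : dElt k A (G + t + 1) = G + u := by
    push_cast at h3
    rw [add_assoc]
    exact h3
  rw [h3']
  refine ⟨by omega, ?_, fun j hj hj' => ?_⟩
  · push_cast
    rw [hG]
    rcases h5 with rfl | h5
    · push_cast
      rw [zmod_cast_period, add_zero]
      exact gate_notMem hA
    · exact h5
  · obtain ⟨v, rfl⟩ : ∃ v : ℕ, j = G + v := ⟨(j - G).toNat, by omega⟩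
    push_cast
    rw [hG]
    exact h4 v (by omega) (by omega)

end

/-! ### The support of the code -/

open scoped Classical in
/-- The residues `i` such that position `i + 1` has a larger value somewhere to its left. -/
noncomputable def codeSupp (k : ℕ) (x : Equiv.Perm ℤ) : Finset (ZMod (k + 1)) :=
  Finset.univ.filter fun r => ∃ j < (r.val : ℤ) + 1, x ((r.val : ℤ) + 1) < x j

theorem mem_codeSupp_iff {x : Equiv.Perm ℤ} {r : ZMod (k + 1)} :
    r ∈ codeSupp k x ↔ ∃ j < (r.val : ℤ) + 1, x ((r.val : ℤ) + 1) < x j := by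
  simp [codeSupp]

theorem TransComm.mem_codeSupp {x : Equiv.Perm ℤ} (hx : TransComm k x) (i : ℤ) :
    (i : ZMod (k + 1)) ∈ codeSupp k x ↔ ∃ j < i + 1, x (i + 1) < x j := by
  obtain ⟨m, hm⟩ := exists_eq_add_mul_of_cast_eq (cast_val_cast (k := k) (i : ZMod (k + 1)))
  rw [mem_codeSupp_iff, hm,
    show i + (k + 1) * m + 1 = i + 1 + (k + 1) * m by ring, hx.apply_add_mul]
  constructor
  · rintro ⟨j, h1, h2⟩
    refine ⟨j + (k + 1) * (-m), by linarith, ?_⟩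
    rw [hx.apply_add_mul]
    linarith
  · rintro ⟨j, h1, h2⟩
    refine ⟨j + (k + 1) * m, by linarith, ?_⟩
    rw [hx.apply_add_mul]
    linarith

theorem TransComm.codeSupp_ne_univ {x : Equiv.Perm ℤ} (hx : TransComm k x) :
    codeSupp k x ≠ Finset.univ := by
  obtain ⟨i, hi⟩ := hx.exists_leftMax
  intro h
  have : ((i - 1 : ℤ) : ZMod (k + 1)) ∈ codeSupp k x := by rw [h]; simp
  rw [hx.mem_codeSupp, sub_add_cancel] at this
  obtain ⟨j, hj, hj'⟩ := this
  exact lt_asymm hj' (hi j hj)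

theorem TransComm.lt_of_codeSupp_subset {y : Equiv.Perm ℤ} (hy : TransComm k y)
    {A : Finset (ZMod (k + 1))} (h : codeSupp k y ⊆ A.image (fun a => a - 1)) {i j : ℤ}
    (hi : (i : ZMod (k + 1)) ∉ A) (hj : j < i) : y j < y i := by
  have : ((i - 1 : ℤ) : ZMod (k + 1)) ∉ codeSupp k y := fun hc => hi (by
    obtain ⟨a, ha, hai⟩ := Finset.mem_image.1 (h hc)
    push_cast at hai
    rwa [← sub_left_injective hai])
  rw [hy.mem_codeSupp, sub_add_cancel] at this
  push Not at this
  exact lt_of_le_of_ne (this j hj) fun e => hj.ne (y.injective e)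

theorem exists_notMem_and_Icc_subset {A : Finset (ZMod (k + 1))} (hA : A ≠ Finset.univ) (i : ℤ) :
    ∃ j ≤ i, (j : ZMod (k + 1)) ∉ A ∧ ∀ t, j < t → t ≤ i → (t : ZMod (k + 1)) ∈ A := by
  obtain ⟨G, t, hG, ht, rfl⟩ := exists_gate_add A i
  obtain ⟨j, ⟨h1, h2⟩, hmax⟩ := Int.exists_greatest_of_bdd
    (P := fun j : ℤ => j ≤ G + t ∧ (j : ZMod (k + 1)) ∉ A) ⟨G + t, fun z hz => hz.1⟩
    ⟨G, by omega, by rw [hG]; exact gate_notMem hA⟩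
  refine ⟨j, h1, h2, fun s hs hs' => ?_⟩
  by_contra hc
  have := hmax s ⟨hs', hc⟩
  omega

section

variable {A : Finset (ZMod (k + 1))} {y : Equiv.Perm ℤ}

/-- The block of `A` containing `i` is jumped over by some earlier position. -/
theorem exists_lt_dElt (hk : 1 ≤ k) (hA : A ≠ Finset.univ) {i : ℤ}
    (hi : (i : ZMod (k + 1)) ∈ A) :
    ∃ j ≤ i, i < dElt k A j ∧ ((dElt k A j : ℤ) : ZMod (k + 1)) ∉ A := by
  obtain ⟨j, h1, h2, h3⟩ := exists_notMem_and_Icc_subset hA i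
  obtain ⟨d1, d2, -⟩ := dElt_of_notMem hk hA h2
  have hne : j ≠ i := fun h => h2 (h ▸ hi)
  refine ⟨j + 1, by omega, ?_, d2⟩
  by_contra hc
  exact d2 (h3 _ (by omega) (by omega))

theorem codeSupp_mul_dElt (hk : 1 ≤ k) (hA : A ≠ Finset.univ) (hy : TransComm k y)
    (h : codeSupp k y ⊆ A.image (fun a => a - 1)) : codeSupp k (y * dElt k A) = A := by
  ext r
  obtain ⟨i, rfl⟩ : ∃ i : ℤ, (i : ZMod (k + 1)) = r := ⟨_, cast_val_cast r⟩
  rw [(hy.mul (dElt_transComm hk A)).mem_codeSupp]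
  simp only [Equiv.Perm.mul_apply]
  constructor
  · rintro ⟨j, hj, hlt⟩
    by_contra hi
    obtain ⟨d1, d2, d3⟩ := dElt_of_notMem hk hA hi
    have hlt' : dElt k A (i + 1) < dElt k A j := by
      by_contra hc
      rcases (not_lt.1 hc).lt_or_eq with hc | hc
      · exact lt_asymm hlt (hy.lt_of_codeSupp_subset h d2 hc)
      · rw [hc] at hlt
        exact lt_irrefl _ hlt
    obtain ⟨j, rfl⟩ : ∃ j', j = j' + 1 := ⟨j - 1, by ring⟩
    by_cases hjA : (j : ZMod (k + 1)) ∈ A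
    · rw [dElt_of_mem hk hA hjA] at hlt'
      omega
    · exact d2 ((dElt_of_notMem hk hA hjA).2.2 _ (by omega) hlt')
  · intro hi
    obtain ⟨j, hj, h1, h2⟩ := exists_lt_dElt hk hA hi
    refine ⟨j, by omega, ?_⟩
    rw [dElt_of_mem hk hA hi]
    exact hy.lt_of_codeSupp_subset h h2 h1

theorem leftInv_mul_dElt_ge (hk : 1 ≤ k) (hA : A ≠ Finset.univ) (hy : TransComm k y)
    (h : codeSupp k y ⊆ A.image (fun a => a - 1)) (i : ℤ) :
    leftInv y (dElt k A (i + 1)) + (if (i : ZMod (k + 1)) ∈ A then 1 else 0) ≤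
      leftInv (y * dElt k A) (i + 1) := by
  have hfin := (hy.mul (dElt_transComm hk A)).finite_leftInv (i + 1)
  by_cases hi : (i : ZMod (k + 1)) ∈ A
  · rw [if_pos hi, dElt_of_mem hk hA hi]
    obtain ⟨p, hp, h1, h2⟩ := exists_lt_dElt hk hA hi
    have hnot : dElt k A p ∉ {j : ℤ | j < i ∧ y i < y j} := fun hc => by
      have := hc.1
      omega
    rw [leftInv, ← Set.ncard_insert_of_notMem hnot (hy.finite_leftInv i), leftInv,
      ← Set.ncard_image_of_injective {j | j < i + 1 ∧ _} (dElt k A).injective]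
    refine Set.ncard_le_ncard ?_ (hfin.image _)
    rintro j (rfl | ⟨hj, hj'⟩)
    · refine ⟨p, ⟨by omega, ?_⟩, rfl⟩
      rw [Equiv.Perm.mul_apply, Equiv.Perm.mul_apply, dElt_of_mem hk hA hi]
      exact hy.lt_of_codeSupp_subset h h2 h1
    · obtain ⟨j, rfl⟩ := (dElt k A).surjective j
      refine ⟨j, ⟨?_, ?_⟩, rfl⟩
      · obtain ⟨j, rfl⟩ : ∃ j', j = j' + 1 := ⟨j - 1, by ring⟩
        by_cases hjA : (j : ZMod (k + 1)) ∈ A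
        · rw [dElt_of_mem hk hA hjA] at hj
          omega
        · have := (dElt_of_notMem hk hA hjA).1
          omega
      · rw [Equiv.Perm.mul_apply, Equiv.Perm.mul_apply, dElt_of_mem hk hA hi]
        exact hj'
  · have : leftInv y (dElt k A (i + 1)) = 0 := by
      rw [leftInv, Set.ncard_eq_zero (hy.finite_leftInv _)]
      ext j
      simp only [Set.mem_ofPred_eq, Set.mem_empty_iff_false, iff_false, not_and, not_lt]
      exact fun hj => (hy.lt_of_codeSupp_subset h (dElt_of_notMem hk hA hi).2.1 hj).le
    rw [this, if_neg hi]
    omega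

theorem invSum_mul_dElt_ge (hk : 1 ≤ k) (hA : A ≠ Finset.univ) (hy : TransComm k y)
    (h : codeSupp k y ⊆ A.image (fun a => a - 1)) :
    invSum k y + A.card ≤ invSum k (y * dElt k A) := by
  have hd := dElt_transComm hk A
  have hshift : TransComm k (Equiv.addRight (1 : ℤ)) := fun i => by
    simp only [Equiv.coe_addRight]; ring
  rw [invSum, ← (hd.mul hshift).sum_comp hy.leftInv_eq, invSum,
    ← hshift.sum_comp (hy.mul hd).leftInv_eq]
  have := Finset.sum_le_sum fun (r : ZMod (k + 1)) (_ : r ∈ Finset.univ) =>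
    leftInv_mul_dElt_ge hk hA hy h (r.val : ℤ)
  rw [Finset.sum_add_distrib] at this
  simpa using this

end

/-- Stripping off the maximal cyclically decreasing right factor shifts the code support. -/
theorem TransComm.codeSupp_mul_inv_dElt (hk : 1 ≤ k) {x : Equiv.Perm ℤ} (hx : TransComm k x) :
    codeSupp k (x * (dElt k (codeSupp k x))⁻¹) ⊆ (codeSupp k x).image (fun a => a - 1) := by
  set A := codeSupp k x with hAdef
  have hA : A ≠ Finset.univ := hx.codeSupp_ne_univ
  have hd := dElt_transComm hk A
  intro r hr
  obtain ⟨i, rfl⟩ : ∃ i : ℤ, ((i - 1 : ℤ) : ZMod (k + 1)) = r := ⟨(r + 1).val, by simp⟩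
  rw [(hx.mul hd.inv).mem_codeSupp, sub_add_cancel] at hr
  refine Finset.mem_image.2 ⟨(i : ZMod (k + 1)), ?_, by push_cast; rfl⟩
  by_contra hi
  obtain ⟨j, hj, hlt⟩ := hr
  obtain ⟨i, rfl⟩ := (dElt k A).surjective i
  obtain ⟨j, rfl⟩ := (dElt k A).surjective j
  simp only [Equiv.Perm.mul_apply, perm_inv_apply] at hlt
  obtain ⟨i, rfl⟩ : ∃ i', i = i' + 1 := ⟨i - 1, by ring⟩
  obtain ⟨j, rfl⟩ : ∃ j', j = j' + 1 := ⟨j - 1, by ring⟩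
  have hiA : (i : ZMod (k + 1)) ∉ A := fun hc => by
    rw [dElt_of_mem hk hA hc] at hi
    exact hi hc
  obtain ⟨d1, d2, d3⟩ := dElt_of_notMem hk hA hiA
  have hmax : ∀ q < i + 1, x q ≤ x (i + 1) := by
    have := hiA
    rw [hAdef, hx.mem_codeSupp] at this
    push Not at this
    exact this
  have block : ∀ p, i + 1 ≤ p → p ≤ dElt k A (i + 1) → x p ≤ x (i + 1) := by
    suffices H : ∀ n : ℕ, i + 1 + n ≤ dElt k A (i + 1) → x (i + 1 + n) ≤ x (i + 1) from
      fun p hp hp' => by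
        obtain ⟨n, rfl⟩ : ∃ n : ℕ, p = i + 1 + n := ⟨(p - (i + 1)).toNat, by omega⟩
        exact H n hp'
    intro n
    induction n using Nat.strong_induction_on with
    | _ n ih =>
      intro hn
      rcases Nat.eq_zero_or_pos n with rfl | hpos
      · simp
      have hmem := d3 (i + n) (by omega) (by omega)
      rw [hAdef, hx.mem_codeSupp, show i + n + 1 = i + 1 + n by ring] at hmem
      obtain ⟨q, hq, hq'⟩ := hmem
      rcases lt_or_ge q (i + 1) with hqi | hqi
      · exact hq'.le.trans (hmax q hqi)
      · obtain ⟨m, rfl⟩ : ∃ m : ℕ, q = i + 1 + m := ⟨(q - (i + 1)).toNat, by omega⟩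
        exact hq'.le.trans (ih m (by omega) (by omega))
  have hij : i < j := by
    by_contra hc
    rcases (not_lt.1 hc).lt_or_eq with hc | rfl
    · exact absurd hlt (not_lt.2 (hmax _ (by omega)))
    · exact lt_irrefl _ hlt
  by_cases hjA : (j : ZMod (k + 1)) ∈ A
  · rw [dElt_of_mem hk hA hjA] at hj
    exact absurd hlt (not_lt.2 (block _ (by omega) (by omega)))
  · obtain ⟨e1, e2, -⟩ := dElt_of_notMem hk hA hjA
    exact e2 (d3 _ (by omega) hj)

theorem eq_one_of_codeSupp_eq_empty {x : Equiv.Perm ℤ} (hx : TransComm k x)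
    (h0 : displacement k x = 0) (h : codeSupp k x = ∅) : x = 1 := by
  have hmono : StrictMono x := fun i j hij =>
    hx.lt_of_codeSupp_subset (A := ∅) (by simp [h]) (by simp) hij
  have hstep : ∀ i, x (i + 1) = x i + 1 := by
    intro i
    obtain ⟨j, hj⟩ := x.surjective (x i + 1)
    have h1 : i < j := hmono.lt_iff_lt.1 (by omega)
    have h2 : x i < x (i + 1) := hmono (by omega)
    have h3 : x (i + 1) ≤ x j := hmono.monotone (by omega)
    omega
  have htrans : ∀ i, x i = x 0 + i := by
    intro i
    induction i with
    | zero => simp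
    | succ m ih => rw [hstep, ih]; ring
    | pred m ih =>
      have := hstep (-m - 1)
      rw [sub_add_cancel, ih] at this
      linarith
  have hz : x 0 = 0 := by
    rw [displacement, Finset.sum_congr rfl fun r _ => by rw [htrans, add_sub_cancel_right]] at h0
    simp only [Finset.sum_const, Finset.card_univ, ZMod.card, nsmul_eq_mul] at h0
    rcases mul_eq_zero.1 h0 with h | h
    · push_cast at h; omega
    · exact h
  ext i
  rw [htrans, hz, zero_add]
  rfl

/-! ### Canonical lists -/

/-- The conditions on the sequence of subsets in a canonical decomposition. -/
def IsCanonical (k : ℕ) (L : List (Finset (ZMod (k + 1)))) : Prop :=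
  (∀ A ∈ L, A.Nonempty ∧ A ≠ Finset.univ) ∧
    List.IsChain (fun A B => B ⊆ A.image (fun a => a - 1)) L

/-- The product of the cyclically decreasing elements of a list of subsets. -/
noncomputable def dProd (k : ℕ) (L : List (Finset (ZMod (k + 1)))) : Equiv.Perm ℤ :=
  (L.reverse.map (dElt k)).prod

theorem dProd_cons (A : Finset (ZMod (k + 1))) (L : List (Finset (ZMod (k + 1)))) :
    dProd k (A :: L) = dProd k L * dElt k A := by
  simp [dProd]

theorem dProd_transComm (hk : 1 ≤ k) (L : List (Finset (ZMod (k + 1)))) :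
    TransComm k (dProd k L) :=
  TransComm.listProd fun y hy => by
    obtain ⟨b, _, rfl⟩ := List.mem_map.1 hy
    exact dElt_transComm hk b

theorem codeSupp_one : codeSupp k 1 = ∅ := by
  refine Finset.eq_empty_of_forall_notMem fun r hr => ?_
  obtain ⟨j, h1, h2⟩ := mem_codeSupp_iff.1 hr
  exact lt_asymm h1 h2

theorem IsCanonical.tail {A : Finset (ZMod (k + 1))} {L : List (Finset (ZMod (k + 1)))}
    (h : IsCanonical k (A :: L)) : IsCanonical k L :=
  ⟨fun B hB => h.1 B (by simp [hB]), h.2.tail⟩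

theorem IsCanonical.codeSupp_dProd (hk : 1 ≤ k) {L : List (Finset (ZMod (k + 1)))}
    (h : IsCanonical k L) : codeSupp k (dProd k L) = L.headD ∅ := by
  induction L with
  | nil => exact codeSupp_one
  | cons A L ih =>
    rw [dProd_cons, codeSupp_mul_dElt hk (h.1 A (by simp)).2 (dProd_transComm hk L)]
    · rfl
    · rw [ih h.tail]
      cases L with
      | nil => simp
      | cons B L => exact (List.isChain_cons_cons.1 h.2).1

theorem IsCanonical.codeSupp_tail_subset (hk : 1 ≤ k) {A : Finset (ZMod (k + 1))}
    {L : List (Finset (ZMod (k + 1)))} (h : IsCanonical k (A :: L)) :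
    codeSupp k (dProd k L) ⊆ A.image (fun a => a - 1) := by
  rw [h.tail.codeSupp_dProd hk]
  cases L with
  | nil => simp
  | cons B L => exact (List.isChain_cons_cons.1 h.2).1

theorem IsCanonical.sum_card_le (hk : 1 ≤ k) {L : List (Finset (ZMod (k + 1)))}
    (h : IsCanonical k L) : (L.map Finset.card).sum ≤ invSum k (dProd k L) := by
  induction L with
  | nil => simp
  | cons A L ih =>
    have h1 := invSum_mul_dElt_ge hk (h.1 A (by simp)).2 (dProd_transComm hk L)
      (h.codeSupp_tail_subset hk)
    have h2 := ih h.tail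
    rw [dProd_cons, List.map_cons, List.sum_cons]
    omega

theorem IsCanonical.eq_of_dProd_eq (hk : 1 ≤ k) {L L' : List (Finset (ZMod (k + 1)))}
    (h : IsCanonical k L) (h' : IsCanonical k L') (e : dProd k L = dProd k L') : L = L' := by
  have hs : L.headD ∅ = L'.headD ∅ := by rw [← h.codeSupp_dProd hk, e, h'.codeSupp_dProd hk]
  induction L generalizing L' with
  | nil =>
    cases L' with
    | nil => rfl
    | cons B L' => exact absurd hs.symm (h'.1 B (by simp)).1.ne_empty
  | cons A L ih =>
    cases L' with
    | nil => exact absurd hs (h.1 A (by simp)).1.ne_empty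
    | cons B L' =>
      obtain rfl : A = B := hs
      rw [dProd_cons, dProd_cons] at e
      have e' := mul_right_cancel e
      rw [ih h.tail h'.tail e'
        (by rw [← h.tail.codeSupp_dProd hk, e', h'.tail.codeSupp_dProd hk])]

theorem exists_word_dProd (L : List (Finset (ZMod (k + 1)))) :
    ∃ w : List (ZMod (k + 1)), w.length ≤ (L.map Finset.card).sum ∧
      dProd k L = (w.map (sAff k)).prod := by
  induction L with
  | nil => exact ⟨[], by simp, by simp [dProd]⟩
  | cons A L ih =>
    obtain ⟨w, h1, h2⟩ := ih
    refine ⟨w ++ dWord k A, ?_, ?_⟩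
    · have := length_dWord_le A
      rw [List.length_append, List.map_cons, List.sum_cons]
      omega
    · rw [dProd_cons, List.map_append, List.prod_append, h2, dElt_eq_dWord]

theorem IsCanonical.affLen_dProd (hk : 1 ≤ k) {L : List (Finset (ZMod (k + 1)))}
    (h : IsCanonical k L) : affLen k (dProd k L) = (L.map Finset.card).sum := by
  obtain ⟨w, h1, h2⟩ := exists_word_dProd L
  have hw : w.length ∈ {n : ℕ | ∃ w : List (ZMod (k + 1)),
      w.length = n ∧ dProd k L = (w.map (sAff k)).prod} := ⟨w, rfl, h2⟩
  refine le_antisymm ((Nat.sInf_le hw).trans h1) ?_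
  obtain ⟨v, hv, hv'⟩ := Nat.sInf_mem ⟨_, hw⟩
  rw [affLen, ← hv]
  refine (h.sum_card_le hk).trans ?_
  rw [hv']
  exact invSum_word_le hk v

theorem exists_isCanonical (hk : 1 ≤ k) {x : Equiv.Perm ℤ} (hx : TransComm k x)
    (h0 : displacement k x = 0) : ∃ L, IsCanonical k L ∧ x = dProd k L := by
  induction hn : invSum k x using Nat.strong_induction_on generalizing x with
  | _ n ih =>
    subst hn
    by_cases he : codeSupp k x = ∅
    · exact ⟨[], ⟨by simp, by simp⟩, by
        rw [eq_one_of_codeSupp_eq_empty hx h0 he]; simp [dProd]⟩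
    set A := codeSupp k x with hAdef
    have hA : A ≠ Finset.univ := hx.codeSupp_ne_univ
    have hne := Finset.nonempty_iff_ne_empty.2 he
    have hd := dElt_transComm hk A
    have hsub := hx.codeSupp_mul_inv_dElt hk
    have hy : TransComm k (x * (dElt k A)⁻¹) := hx.mul hd.inv
    have hlen := invSum_mul_dElt_ge hk hA hy hsub
    rw [inv_mul_cancel_right] at hlen
    have hpos := hne.card_pos
    obtain ⟨L, hL, hLx⟩ := ih _ (by omega) hy
      (by rw [displacement_mul hx hd.inv, displacement_inv hd, displacement_dElt hk, h0]; simp) rfl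
    refine ⟨A :: L, ⟨?_, ?_⟩, by rw [dProd_cons, ← hLx, inv_mul_cancel_right]⟩
    · intro B hB
      rcases List.mem_cons.1 hB with rfl | hB
      · exact ⟨hne, hA⟩
      · exact hL.1 B hB
    · cases L with
      | nil => simp
      | cons B L =>
        refine List.isChain_cons_cons.2 ⟨?_, hL.2⟩
        have := hL.codeSupp_dProd hk
        rw [← hLx] at this
        rw [this] at hsub
        exact hsub

end AffinePermutations

/-- every affine permutation has a unique decomposition
`x = d_{A_n} ⋯ d_{A_1}` with `A_{m+1} ⊆ A_m − 1` and `ℓ(x) = ∑ |A_m|`. -/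
theorem canonical_decreasing_decomposition (k : ℕ) (hk : 1 ≤ k) (x : Equiv.Perm ℤ)
    (hx : IsAffinePerm k x) :
    ∃! L : List (Finset (ZMod (k + 1))),
      (∀ A ∈ L, A.Nonempty ∧ A ≠ Finset.univ) ∧
      List.Chain' (fun A B => B ⊆ A.image (fun a => a - 1)) L ∧
      x = (L.reverse.map (dElt k)).prod ∧
      affLen k x = (L.map Finset.card).sum := by
  have hc : TransComm k x := hx.1
  obtain ⟨L, hL, rfl⟩ := exists_isCanonical hk hc hx.displacement_eq_zero
  refine ⟨L, ⟨hL.1, hL.2, rfl, hL.affLen_dProd hk⟩, ?_⟩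
  rintro L' ⟨h1, h2, h3, -⟩
  exact IsCanonical.eq_of_dProd_eq hk ⟨h1, h2⟩ hL h3.symm
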